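/- arXiv:1503.07006 — 4 statements merged into one kernel-verified Lean document; each statement's English description precedes it below -/
import Mathlib

section
/- For every integer n ≥ 1, the element w is a non-zero-divisor in R: for every y ∈ R, if y·w = 0 then y = 0. -/
open MvPolynomial

noncomputable section

/-- The polynomial ring `(ℤ/2)[x,v,w]`. -/
abbrev P : Type := MvPolynomial (Fin 3) (ZMod 2)

/-- The ideal `(x^{2n+2}, v² + (n+1)·x^{2n}·w)` (the coefficient `n+1` read mod 2). -/
def relIdeal (n : ℕ) : Ideal P :=
  Ideal.span {(X 0 : P) ^ (2 * n + 2),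
    (X 1 : P) ^ 2 + C ((n : ZMod 2) + 1) * (X 0 : P) ^ (2 * n) * X 2}

/-- `R = (ℤ/2)[x,v,w]/(x^{2n+2}, v² + (n+1)x^{2n}w) ≅ ℍ_*(L ℝP^{2n+1}; ℤ/2)`. -/
abbrev R (n : ℕ) : Type := P ⧸ relIdeal n

/-- The quotient map as a `ℤ/2`-algebra homomorphism. -/
def mkR (n : ℕ) : P →ₐ[ZMod 2] R n := Ideal.Quotient.mkₐ (ZMod 2) (relIdeal n)

def x (n : ℕ) : R n := mkR n (X 0)
def v (n : ℕ) : R n := mkR n (X 1)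
def w (n : ℕ) : R n := mkR n (X 2)

theorem X_dvd_sub_aeval_update_zero {σ k : Type*} [DecidableEq σ] [CommRing k] (i : σ)
    (p : MvPolynomial σ k) :
    (X i : MvPolynomial σ k) ∣ p - aeval (Function.update X i 0) p := by
  induction p using MvPolynomial.induction_on with
  | C a => simp [MvPolynomial.algebraMap_eq]
  | add p q hp hq =>
    rw [map_add, add_sub_add_comm]
    exact dvd_add hp hq
  | mul_X p j hp =>
    rw [map_mul, aeval_X]
    by_cases h : j = i
    · subst h
      simp
    · rw [Function.update_of_ne h, ← sub_mul]
      exact hp.mul_right _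

/-- `w` is a non-zero-divisor in `R`. -/
theorem stmt_4 (n : ℕ) (hn : 1 ≤ n) :
    ∀ y : R n, y * w n = 0 → y = 0 := by
  intro y hy
  obtain ⟨p, rfl⟩ := Ideal.Quotient.mk_surjective y
  have hmem : p * X 2 ∈ relIdeal n := Ideal.Quotient.eq_zero_iff_mem.mp hy
  rw [Ideal.Quotient.eq_zero_iff_mem]
  obtain ⟨a, b, hab⟩ := Ideal.mem_span_pair.mp hmem
  have h := congrArg (aeval (Function.update X 2 0) : P →ₐ[ZMod 2] P) hab
  obtain ⟨a', ha⟩ := X_dvd_sub_aeval_update_zero 2 a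
  obtain ⟨b', hb⟩ := X_dvd_sub_aeval_update_zero 2 b
  simp only [map_add, map_mul, map_pow, aeval_X, Function.update_self, mul_zero, add_zero,
    Function.update_of_ne (show (0 : Fin 3) ≠ 2 by decide),
    Function.update_of_ne (show (1 : Fin 3) ≠ 2 by decide)] at h
  generalize (aeval (Function.update X 2 0) : P →ₐ[ZMod 2] P) a = a₀ at *
  generalize (aeval (Function.update X 2 0) : P →ₐ[ZMod 2] P) b = b₀ at *
  have hv : ¬ (X 0 : P) ∣ X 1 ^ 2 := fun hd => by
    have := (X_prime : Prime (X 0 : P)).dvd_of_dvd_pow hd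
    simp [X_dvd_X] at this
  obtain ⟨d, rfl⟩ : (X 0 : P) ^ (2 * n + 2) ∣ b₀ :=
    (X_prime : Prime (X 0 : P)).pow_dvd_of_dvd_mul_right _ hv ⟨-a₀, by linear_combination h⟩
  refine Ideal.mem_span_pair.mpr
    ⟨a' + d * C ((n : ZMod 2) + 1) * X 0 ^ (2 * n), b', ?_⟩
  apply mul_right_cancel₀ (X_ne_zero (2 : Fin 3) : (X 2 : P) ≠ 0)
  linear_combination hab - h - X 0 ^ (2 * n + 2) * ha -
    (X 1 ^ 2 + C ((n : ZMod 2) + 1) * X 0 ^ (2 * n) * X 2) * hb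

end
end

section
/- Let n ≥ 1, let a₁, a₂, a₃ ∈ ℤ/2, and set x̃ := x + a₁·x·v + a₂·x^{2n+1}·w + a₃·x^{2n+1}·v·w in R. Then for every integer k ≥ 2: if k is even or a₁ = 0 then x̃^k = x^k, and if k is odd and a₁ = 1 then x̃^k = x^k + x^k·v. -/
open MvPolynomial

noncomputable section

theorem x_pow_eq_zero (n : ℕ) : x n ^ (2 * n + 2) = 0 := by
  rw [x, ← map_pow]
  exact Ideal.Quotient.eq_zero_iff_mem.mpr (Ideal.subset_span (Set.mem_insert _ _))

theorem v_sq_add (n : ℕ) :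
    v n ^ 2 + mkR n (C ((n : ZMod 2) + 1)) * x n ^ (2 * n) * w n = 0 := by
  simp only [x, v, w, ← map_pow, ← map_mul, ← map_add]
  exact Ideal.Quotient.eq_zero_iff_mem.mpr (Ideal.subset_span (Set.mem_insert_of_mem _ rfl))

theorem two_eq_zero_R (n : ℕ) : (2 : R n) = 0 := by
  have h : algebraMap (ZMod 2) (R n) 2 = 0 := by
    rw [show (2 : ZMod 2) = 0 from rfl, map_zero]
  rwa [map_ofNat] at h

theorem smul_eq_algebraMap_mul {n : ℕ} (a : ZMod 2) (r : R n) :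
    a • r = algebraMap (ZMod 2) (R n) a * r :=
  Algebra.smul_def a r

theorem x_sq_mul_v_sq (n : ℕ) : x n ^ 2 * v n ^ 2 = 0 := by
  linear_combination x n ^ 2 * v_sq_add n
    - mkR n (C ((n : ZMod 2) + 1)) * w n * x_pow_eq_zero n

theorem add_sq_R {n : ℕ} (a b : R n) : (a + b) ^ 2 = a ^ 2 + b ^ 2 := by
  linear_combination a * b * two_eq_zero_R n

theorem perturbed_x_sq (n : ℕ) (a b c : R n) :
    (x n + a * (x n * v n) + b * (x n ^ (2 * n + 1) * w n)
      + c * (x n ^ (2 * n + 1) * v n * w n)) ^ 2 = x n ^ 2 := by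
  simp only [add_sq_R]
  linear_combination a ^ 2 * x_sq_mul_v_sq n
    + (b ^ 2 * w n ^ 2 + c ^ 2 * v n ^ 2 * w n ^ 2) * x n ^ (2 * n) * x_pow_eq_zero n

theorem perturbed_x_pow_odd (n m : ℕ) (a b c : R n) :
    (x n + a * (x n * v n) + b * (x n ^ (2 * n + 1) * w n)
      + c * (x n ^ (2 * n + 1) * v n * w n)) ^ (2 * (m + 1) + 1)
      = x n ^ (2 * (m + 1) + 1) + a * (x n ^ (2 * (m + 1) + 1) * v n) := by
  rw [pow_succ, pow_mul, perturbed_x_sq]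
  linear_combination (b * w n + c * v n * w n) * x n ^ (2 * m + 1) * x_pow_eq_zero n

/-- Powers of `x̃ = x + a₁ x v + a₂ x^{2n+1} w + a₃ x^{2n+1} v w`:
for `k ≥ 2`, `x̃^k = x^k` if `k` is even or `a₁ = 0`, and
`x̃^k = x^k + x^k v` if `k` is odd and `a₁ = 1`. -/
theorem stmt_5 (n : ℕ) (hn : 1 ≤ n) (a₁ a₂ a₃ : ZMod 2) (xt : R n)
    (hxt : xt = x n + a₁ • (x n * v n) + a₂ • (x n ^ (2 * n + 1) * w n)
      + a₃ • (x n ^ (2 * n + 1) * v n * w n)) :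
    ∀ k : ℕ, 2 ≤ k →
      ((Even k ∨ a₁ = 0) → xt ^ k = x n ^ k) ∧
      ((Odd k ∧ a₁ = 1) → xt ^ k = x n ^ k + x n ^ k * v n) := by
  intro k hk
  simp only [smul_eq_algebraMap_mul] at hxt
  rcases Nat.even_or_odd' k with ⟨m, rfl | rfl⟩
  · refine ⟨fun _ => ?_, fun h => absurd h.1 (by simp)⟩
    rw [hxt, pow_mul, perturbed_x_sq, pow_mul]
  · obtain ⟨m, rfl⟩ : ∃ j, m = j + 1 := ⟨m - 1, by omega⟩
    rw [hxt, perturbed_x_pow_odd]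
    refine ⟨fun h => ?_, fun h => ?_⟩
    · have h₀ : a₁ = 0 := h.resolve_left (by simp)
      simp [h₀]
    · simp [h.2]

end
end

section
/- Let n ≥ 1 and suppose (R, Δ) is a char-2 B-V datum on R with Δ(x) = 0 and Δ(x^{2n+1}·v) = x^{2n}·v. Then x^{2n}·Δ(v) = 0 and x^{2n}·{x,v} = x^{2n}·v. -/
open MvPolynomial

noncomputable section

/-- If `Δ x = 0`, then `Δ` commutes with multiplication by even powers of `x`. -/
theorem map_pow_two_mul_mul_of_bracket {A : Type*} [CommRing A]
    {Δ : A → A} {br : A → A → A}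
    (hbr : ∀ a b : A, br a b = Δ (a * b) + Δ a * b + a * Δ b)
    (halt : ∀ a : A, br a a = 0)
    (hleib : ∀ a b c : A, br a (b * c) = br a b * c + b * br a c)
    {x : A} (hx : Δ x = 0) (k : ℕ) (a : A) :
    Δ (x ^ (2 * k) * a) = x ^ (2 * k) * Δ a := by
  have hsq (b : A) : Δ (x * (x * b)) = x * (x * Δ b) := by
    have h := hleib x x b
    rw [halt, hbr, hbr, hx] at h
    linear_combination h
  induction k with
  | zero => simp
  | succ k ih =>
    rw [show x ^ (2 * (k + 1)) * a = x * (x * (x ^ (2 * k) * a)) by ring, hsq, ih]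
    ring

/-- If `(R, Δ)` is a char-2 B-V datum with `Δ x = 0` and `Δ(x^{2n+1}·v) = x^{2n}·v`,
then `x^{2n}·Δ v = 0` and `x^{2n}·⁅x,v⁆ = x^{2n}·v`. -/
theorem stmt_12 (n : ℕ) (hn : 1 ≤ n)
    (Δ : R n → R n) (hΔadd : ∀ a b : R n, Δ (a + b) = Δ a + Δ b)
    (hΔΔ : ∀ a : R n, Δ (Δ a) = 0)
    (br : R n → R n → R n)
    (hbr : ∀ a b : R n, br a b = Δ (a * b) + Δ a * b + a * Δ b)
    (halt : ∀ a : R n, br a a = 0)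
    (hleib : ∀ a b c : R n, br a (b * c) = br a b * c + b * br a c)
    (hΔx : Δ (x n) = 0)
    (hkey : Δ (x n ^ (2 * n + 1) * v n) = x n ^ (2 * n) * v n) :
    x n ^ (2 * n) * Δ (v n) = 0 ∧ x n ^ (2 * n) * br (x n) (v n) = x n ^ (2 * n) * v n := by
  have heven := map_pow_two_mul_mul_of_bracket hbr halt hleib hΔx n
  have hv : x n ^ (2 * n) * Δ (v n) = 0 := by
    rw [← heven, ← hkey, hΔΔ]
  refine ⟨hv, ?_⟩
  rw [pow_succ, mul_assoc, heven] at hkey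
  rw [hbr, hΔx]
  linear_combination hkey + x n * hv

end
end

section
/- Let n ≥ 2 and suppose (R, Δ) is a char-2 B-V datum on R such that Δ(x) = 0, Δ(v) = 0, Δ(w) = 0, {x,v} = v or {x,v} = v + x^{2n}·v·w, and {v,w} = 0 or {v,w} = x^{2n−1}·v·w². Then {v,w} = 0. -/
open MvPolynomial

noncomputable section

theorem add_self_eq_zero_R (n : ℕ) (a : R n) : a + a = 0 := by
  rw [← two_smul (ZMod 2) a, show (2 : ZMod 2) = 0 from rfl, zero_smul]

/-- The defining ideal is contained in the monomial ideal `(x^{2n}, v²)`. -/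
theorem relIdeal_le_span_monomial (n : ℕ) :
    relIdeal n ≤ Ideal.span ((fun s => monomial s (1 : ZMod 2)) ''
      {Finsupp.single (0 : Fin 3) (2 * n), Finsupp.single 1 2}) := by
  rw [Set.image_pair, ← X_pow_eq_monomial, ← X_pow_eq_monomial, relIdeal, Ideal.span_le]
  have hx : (X 0 : P) ^ (2 * n) ∈ Ideal.span {(X 0 : P) ^ (2 * n), (X 1 : P) ^ 2} :=
    Ideal.subset_span (by simp)
  have hv : (X 1 : P) ^ 2 ∈ Ideal.span {(X 0 : P) ^ (2 * n), (X 1 : P) ^ 2} :=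
    Ideal.subset_span (by simp)
  rintro p (rfl | rfl)
  · rw [pow_add]
    exact Ideal.mul_mem_right _ _ hx
  · exact Ideal.add_mem _ hv (Ideal.mul_mem_right _ _ (Ideal.mul_mem_left _ _ hx))

theorem x_pow_mul_v_mul_w_pow_ne_zero (n i j : ℕ) (hi : i < 2 * n) :
    x n ^ i * v n * w n ^ j ≠ 0 := by
  intro h
  have hmem : (X 0 : P) ^ i * X 1 * X 2 ^ j ∈ relIdeal n := by
    rw [← Ideal.Quotient.eq_zero_iff_mem]
    simpa [x, v, w, mkR] using h
  have hmon : (X 0 : P) ^ i * X 1 * X 2 ^ j =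
      monomial (Finsupp.single 0 i + Finsupp.single 1 1 + Finsupp.single 2 j) 1 := by
    rw [X_pow_eq_monomial, X_pow_eq_monomial, X, monomial_mul, monomial_mul, one_mul, one_mul]
  have hspan := relIdeal_le_span_monomial n hmem
  rw [hmon, mem_ideal_span_monomial_image] at hspan
  obtain ⟨s, hs, hle⟩ := hspan (Finsupp.single 0 i + Finsupp.single 1 1 + Finsupp.single 2 j)
    (by simp [support_monomial])
  rcases hs with rfl | rfl
  · have := hle 0
    simp at this
    omega
  · have := hle 1
    simp at this

/-- In a char-2 B-V datum on `R`, the operator `Δ` is linear over squares. -/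
theorem delta_mul_sq (n : ℕ) (Δ : R n → R n) (br : R n → R n → R n)
    (hbr : ∀ a b : R n, br a b = Δ (a * b) + Δ a * b + a * Δ b)
    (halt : ∀ a : R n, br a a = 0)
    (hleib : ∀ a b c : R n, br a (b * c) = br a b * c + b * br a c) (a b : R n) :
    Δ (a * b ^ 2) = Δ a * b ^ 2 := by
  have hsq : Δ (b ^ 2) = 0 := by
    have h := hbr b b
    rw [halt, mul_comm b (Δ b), add_assoc, add_self_eq_zero_R, add_zero] at h
    rw [pow_two, ← h]
  have hbsq : br a (b ^ 2) = 0 := by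
    rw [pow_two, hleib, mul_comm b, add_self_eq_zero_R]
  have h := hbr a (b ^ 2)
  rw [hbsq, hsq, mul_zero, add_zero] at h
  linear_combination -h - add_self_eq_zero_R n (Δ a * b ^ 2)

/-- If `n ≥ 2` and `(R, Δ)` is a char-2 B-V datum with `Δ x = Δ v = Δ w = 0`,
`⁅x,v⁆ = v` or `v + x^{2n} v w`, and `⁅v,w⁆ = 0` or `x^{2n-1} v w²`, then `⁅v,w⁆ = 0`. -/
theorem stmt_14 (n : ℕ) (hn : 2 ≤ n)
    (Δ : R n → R n) (hΔadd : ∀ a b : R n, Δ (a + b) = Δ a + Δ b)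
    (hΔΔ : ∀ a : R n, Δ (Δ a) = 0)
    (br : R n → R n → R n)
    (hbr : ∀ a b : R n, br a b = Δ (a * b) + Δ a * b + a * Δ b)
    (halt : ∀ a : R n, br a a = 0)
    (hleib : ∀ a b c : R n, br a (b * c) = br a b * c + b * br a c)
    (hΔx : Δ (x n) = 0) (hΔv : Δ (v n) = 0) (hΔw : Δ (w n) = 0)
    (hxv : br (x n) (v n) = v n ∨
      br (x n) (v n) = v n + x n ^ (2 * n) * v n * w n)
    (hvw : br (v n) (w n) = 0 ∨
      br (v n) (w n) = x n ^ (2 * n - 1) * v n * w n ^ 2) :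
    br (v n) (w n) = 0 := by
  refine hvw.resolve_right fun hq => x_pow_mul_v_mul_w_pow_ne_zero n (2 * n - 2) 2 (by omega) ?_
  obtain ⟨k, hk⟩ := Nat.exists_eq_add_of_le hn
  have hΔxv : Δ (x n * v n) = br (x n) (v n) := by simp [hbr, hΔx, hΔv]
  have hΔq : Δ (br (v n) (w n)) = 0 := by simp [hbr, hΔv, hΔw, hΔΔ]
  have hfactor : x n ^ (2 * n - 1) * v n * w n ^ 2 =
      x n * v n * (x n ^ (k + 1) * w n) ^ 2 := by
    rw [show 2 * n - 1 = 2 * k + 3 by omega]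
    ring
  rw [hq, hfactor, delta_mul_sq n Δ br hbr halt hleib, hΔxv] at hΔq
  rw [show 2 * n - 2 = 2 * k + 2 by omega]
  rcases hxv with h | h
  · rw [h] at hΔq
    linear_combination hΔq
  · have hx := x_pow_eq_zero n
    rw [h] at hΔq
    linear_combination hΔq - x n ^ (2 * k) * v n * w n ^ 3 * hx

end
end
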